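/- Let u ∈ ℝ² be a unit vector and r > 0. Then ⋂_{y ∈ C_{u,r}} B(y,r) = B(0,r) ∩ B(v₁,r) ∩ B(v₂,r), where v₁ = r·ℛ(u) and v₂ = r·ℛ^{-1}(u) and ℛ : ℝ² → ℝ² is the counter-clockwise rotation by angle π/6. (The right-hand side is a Reuleaux triangle of width r.) -/

import Mathlib

open MeasureTheory Metric Set
open scoped RealInnerProductSpace ENNReal Real

noncomputable section

/-- The Euclidean plane. -/
abbrev E2 := EuclideanSpace ℝ (Fin 2)

/-- The point `(a, b)` of the Euclidean plane. -/
def pt (a b : ℝ) : E2 := (WithLp.equiv 2 (Fin 2 → ℝ)).symm ![a, b]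

/-- The cone `C_u^θ = {x : ⟪x, u⟫ ≥ ‖x‖ cos θ}`. -/
def cone (u : E2) (θ : ℝ) : Set E2 := {x | ‖x‖ * Real.cos θ ≤ ⟪x, u⟫}

/-- The circular sector `C_{u,r}^θ = C_u^θ ∩ B(0, r)`. -/
def sector (u : E2) (θ r : ℝ) : Set E2 := cone u θ ∩ closedBall (0 : E2) r

/-- Counter-clockwise rotation of the plane by angle `θ`. -/
def rot (θ : ℝ) (x : E2) : E2 :=
  pt (Real.cos θ * x 0 - Real.sin θ * x 1) (Real.sin θ * x 0 + Real.cos θ * x 1)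

theorem aux_norm_sq (x : E2) : ‖x‖ ^ 2 = x 0 ^ 2 + x 1 ^ 2 := by
  rw [EuclideanSpace.norm_sq_eq]; simp [Fin.sum_univ_two]

theorem aux_ball (x y : E2) (r : ℝ) (hr : 0 < r) :
    x ∈ closedBall y r ↔ (x 0 - y 0) ^ 2 + (x 1 - y 1) ^ 2 ≤ r ^ 2 := by
  rw [mem_closedBall, dist_eq_norm, ← abs_of_nonneg (norm_nonneg (x - y)), ← abs_of_pos hr,
    ← sq_le_sq, aux_norm_sq, abs_of_pos hr]
  simp

theorem aux_inner (x y : E2) : ⟪x, y⟫ = x 0 * y 0 + x 1 * y 1 := by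
  simp [PiLp.inner_apply, Fin.sum_univ_two]; ring

theorem aux_real (k c d r x0 x1 y0 y1 t : ℝ) (hk : k ^ 2 = 3) (hk0 : 0 < k)
    (hu : c ^ 2 + d ^ 2 = 1) (hr : 0 < r) (ht0 : 0 ≤ t) (htr : t ≤ r)
    (ht : t ^ 2 = y0 ^ 2 + y1 ^ 2) (hc : t * (k / 2) ≤ y0 * c + y1 * d)
    (h0 : x0 ^ 2 + x1 ^ 2 ≤ r ^ 2)
    (h1 : (x0 - r * (k / 2 * c - 1 / 2 * d)) ^ 2 + (x1 - r * (1 / 2 * c + k / 2 * d)) ^ 2 ≤ r ^ 2)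
    (h2 : (x0 - r * (k / 2 * c + 1 / 2 * d)) ^ 2 + (x1 - r * (-(1 / 2) * c + k / 2 * d)) ^ 2
      ≤ r ^ 2) :
    (x0 - y0) ^ 2 + (x1 - y1) ^ 2 ≤ r ^ 2 := by
  obtain ⟨α, hα⟩ : ∃ α, α = y0 * c + y1 * d := ⟨_, rfl⟩
  obtain ⟨β, hβ⟩ : ∃ β, β = c * y1 - d * y0 := ⟨_, rfl⟩
  obtain ⟨p, hp⟩ : ∃ p, p = x0 * (k / 2 * c - 1 / 2 * d) + x1 * (1 / 2 * c + k / 2 * d) :=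
    ⟨_, rfl⟩
  obtain ⟨q, hq⟩ : ∃ q, q = x0 * (k / 2 * c + 1 / 2 * d) + x1 * (-(1 / 2) * c + k / 2 * d) :=
    ⟨_, rfl⟩
  obtain ⟨S, hS⟩ : ∃ S, S = x0 ^ 2 + x1 ^ 2 := ⟨_, rfl⟩
  have n1 : (k / 2 * c - 1 / 2 * d) ^ 2 + (1 / 2 * c + k / 2 * d) ^ 2 = 1 := by
    linear_combination (k ^ 2 / 4 + 1 / 4) * hu + hk / 4
  have n2 : (k / 2 * c + 1 / 2 * d) ^ 2 + (-(1 / 2) * c + k / 2 * d) ^ 2 = 1 := by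
    linear_combination (k ^ 2 / 4 + 1 / 4) * hu + hk / 4
  have hp1 : S ≤ 2 * r * p := by
    have : S - 2 * r * p + r ^ 2 ≤ r ^ 2 := by
      refine le_trans (le_of_eq ?_) h1
      rw [hS, hp]; linear_combination -r ^ 2 * n1
    linarith
  have hq1 : S ≤ 2 * r * q := by
    have : S - 2 * r * q + r ^ 2 ≤ r ^ 2 := by
      refine le_trans (le_of_eq ?_) h2
      rw [hS, hq]; linear_combination -r ^ 2 * n2
    linarith
  rw [← hα] at hc
  have hα0 : 0 ≤ α := le_trans (by positivity) hc
  have htab : t ^ 2 = α ^ 2 + β ^ 2 := by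
    rw [ht, hα, hβ]; linear_combination -(y0 ^ 2 + y1 ^ 2) * hu
  have hb : |β| ≤ k * α / 3 := by
    apply abs_le_of_sq_le_sq _ (by positivity)
    have h3 : (t * (k / 2)) ^ 2 ≤ α ^ 2 := pow_le_pow_left₀ (by positivity) hc 2
    have e1 : (t * (k / 2)) ^ 2 = 3 / 4 * t ^ 2 := by linear_combination t ^ 2 / 4 * hk
    have e2 : (k * α / 3) ^ 2 = α ^ 2 / 3 := by linear_combination α ^ 2 / 9 * hk
    rw [e2]; linarith
  obtain ⟨hb1, hb2⟩ := abs_le.mp hb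
  have hab : t ≤ 2 * (k * α / 3) := by
    have := mul_le_mul_of_nonneg_left hc hk0.le
    have e : k * (t * (k / 2)) = 3 / 2 * t := by linear_combination t / 2 * hk
    linarith
  have hxy : x0 * y0 + x1 * y1 = (k * α / 3 + β) * p + (k * α / 3 - β) * q := by
    rw [hα, hβ, hp, hq]
    linear_combination -(x0 * y0 + x1 * y1) * hu
      - ((y0 * c + y1 * d) * (x0 * c + x1 * d) / 3) * hk
  have hS0 : 0 ≤ S := by rw [hS]; positivity
  have m1 := mul_le_mul_of_nonneg_left hp1 (show 0 ≤ k * α / 3 + β by linarith)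
  have m2 := mul_le_mul_of_nonneg_left hq1 (show 0 ≤ k * α / 3 - β by linarith)
  have m3 := mul_le_mul_of_nonneg_right hab hS0
  have key : t * S ≤ 2 * r * (x0 * y0 + x1 * y1) := by rw [hxy]; linarith
  have hSr : S ≤ r ^ 2 := by rw [hS]; exact h0
  have m4 := mul_le_mul_of_nonneg_left hSr (show 0 ≤ r - t by linarith)
  have m5 : 0 ≤ r * (t * (r - t)) := mul_nonneg hr.le (mul_nonneg ht0 (by linarith))
  have fin : r * ((x0 - y0) ^ 2 + (x1 - y1) ^ 2) ≤ r * r ^ 2 := by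
    have : r * ((x0 - y0) ^ 2 + (x1 - y1) ^ 2)
        = r * S + r * t ^ 2 - 2 * r * (x0 * y0 + x1 * y1) := by rw [hS, ht]; ring
    rw [this]; clear hxy hp hq hS n1 n2 h1 h2 m1 m2 m3; linarith only [m4, m5, key]
  exact le_of_mul_le_mul_left fin hr

theorem aux_mem (u : E2) (hu : ‖u‖ = 1) (r : ℝ) (hr : 0 < r) (θ : ℝ)
    (hθ : Real.cos θ = Real.cos (π / 6)) : r • rot θ u ∈ sector u (π / 6) r := by
  have hu2 := aux_norm_sq u
  rw [hu] at hu2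
  have hn : ‖rot θ u‖ = 1 := by
    have : ‖rot θ u‖ ^ 2 = 1 := by
      rw [aux_norm_sq]; simp only [rot, pt]; simp
      linear_combination (-(Real.sin θ ^ 2 + Real.cos θ ^ 2)) * hu2 + Real.sin_sq_add_cos_sq θ
    exact (pow_eq_one_iff_of_nonneg (norm_nonneg _) two_ne_zero).mp this
  have hn' : ‖r • rot θ u‖ = r := by rw [norm_smul, hn, Real.norm_of_nonneg hr.le, mul_one]
  refine ⟨?_, by simp [hn']⟩
  show ‖r • rot θ u‖ * _ ≤ _
  rw [hn', ← hθ, aux_inner]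
  apply le_of_eq
  simp [rot, pt]
  linear_combination (r * Real.cos θ) * hu2

theorem statement9
    (u : E2) (hu : ‖u‖ = 1) (r : ℝ) (hr : 0 < r) :
    (⋂ y ∈ sector u (π / 6) r, closedBall y r)
      = closedBall (0 : E2) r ∩ closedBall (r • rot (π / 6) u) r
          ∩ closedBall (r • rot (-(π / 6)) u) r := by
  ext x
  constructor
  · intro h
    simp only [mem_iInter] at h
    refine ⟨⟨h 0 ⟨?_, ?_⟩, h _ (aux_mem u hu r hr _ rfl)⟩,
      h _ (aux_mem u hu r hr _ (Real.cos_neg _))⟩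
    · simp [cone]
    · simp [hr.le]
  · rintro ⟨⟨h0, h1⟩, h2⟩
    simp only [mem_iInter]
    rintro y ⟨hy1, hy2⟩
    have hu2 := aux_norm_sq u
    rw [hu] at hu2
    change ‖y‖ * _ ≤ _ at hy1
    rw [aux_inner, Real.cos_pi_div_six] at hy1
    rw [aux_ball _ _ _ hr] at h0 h1 h2 ⊢
    refine aux_real (√3) (u 0) (u 1) r (x 0) (x 1) (y 0) (y 1) ‖y‖ (by simp) (by simp)
      (by linarith) hr (norm_nonneg _) (by simpa using hy2) (aux_norm_sq y) hy1
      (by simpa using h0) ?_ ?_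
    · simpa [rot, pt] using h1
    · simpa [rot, pt] using h2
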